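/- arXiv:2103.01615 — 2 statements merged into one kernel-verified Lean document; each statement's English description precedes it below -/
import Mathlib

section
/- Let SSE be the Slot Set Encoder with fixed linear maps q, k, v. For every input X ∈ ℝ^{n×d}, every slot matrix S ∈ ℝ^{K×h}, and every pair of permutation matrices π_X ∈ ℝ^{n×n} and π_S ∈ ℝ^{K×K}, it holds that SSE(π_X · X, π_S · S) = π_S · SSE(X, S); i.e., the Slot Set Encoder is permutation invariant with respect to the input set elements and permutation equivariant with respect to the slots. -/
open Matrix

/-- The sigmoid function `σ(z) = 1/(1+e^{-z})`. -/
noncomputable def sigmoid (z : ℝ) : ℝ := 1 / (1 + Real.exp (-z))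

/-- The Slot Set Encoder (see the paper): `M(X,S) = (1/√d̂)·k(X)·q(S)ᵀ`,
`attn(X,S) = σ(M(X,S))` entrywise, `W(X,S)_{i,j} = attn(X,S)_{i,j}/∑_l attn(X,S)_{i,l}`,
`SSE(X,S) = W(X,S)ᵀ·v(X)`, where the row-wise linear maps `k, v, q` are given by right
multiplication with `Km, Vm, Qm`. -/
noncomputable def SSE {n d dh h K : ℕ}
    (Km : Matrix (Fin d) (Fin dh) ℝ) (Qm : Matrix (Fin h) (Fin dh) ℝ)
    (Vm : Matrix (Fin d) (Fin dh) ℝ)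
    (X : Matrix (Fin n) (Fin d) ℝ) (S : Matrix (Fin K) (Fin h) ℝ) :
    Matrix (Fin K) (Fin dh) ℝ :=
  let M : Matrix (Fin n) (Fin K) ℝ := (1 / Real.sqrt dh) • (X * Km * (S * Qm)ᵀ)
  let attn : Matrix (Fin n) (Fin K) ℝ := Matrix.of fun i j => sigmoid (M i j)
  let W : Matrix (Fin n) (Fin K) ℝ := Matrix.of fun i j => attn i j / ∑ l, attn i l
  Wᵀ * (X * Vm)

/-- A permutation matrix: a square 0–1 matrix with exactly one 1 in each row and each column. -/
def IsPermMatrix {m : ℕ} (P : Matrix (Fin m) (Fin m) ℝ) : Prop :=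
  (∀ i j, P i j = 0 ∨ P i j = 1) ∧ (∀ i, ∃! j, P i j = 1) ∧ (∀ j, ∃! i, P i j = 1)

/-- Left multiplication by a permutation matrix permutes the rows. -/
theorem IsPermMatrix.exists_mul_eq_submatrix {m : ℕ} {P : Matrix (Fin m) (Fin m) ℝ}
    (hP : IsPermMatrix P) :
    ∃ e : Equiv.Perm (Fin m), ∀ {p : ℕ} (A : Matrix (Fin m) (Fin p) ℝ),
      P * A = A.submatrix e id := by
  obtain ⟨h01, hrow, hcol⟩ := hP
  choose f hf hf' using hrow
  have hinj : Function.Injective f := fun a b hab =>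
    (hcol (f a)).unique (hf a) (by rw [hab]; exact hf b)
  refine ⟨Equiv.ofBijective f hinj.bijective_of_finite, fun A => ?_⟩
  ext i j
  rw [Matrix.mul_apply, Finset.sum_eq_single (f i)]
  · simp [hf]
  · intro b _ hb
    rcases h01 i b with h | h
    · simp [h]
    · exact absurd (hf' i b h) hb
  · simp

/-- Permuting the rows of the input leaves the encoding unchanged, and permuting the slots
permutes the rows of the encoding. -/
theorem SSE_submatrix {n d dh h K : ℕ}
    (Km : Matrix (Fin d) (Fin dh) ℝ) (Qm : Matrix (Fin h) (Fin dh) ℝ)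
    (Vm : Matrix (Fin d) (Fin dh) ℝ)
    (X : Matrix (Fin n) (Fin d) ℝ) (S : Matrix (Fin K) (Fin h) ℝ)
    (e : Equiv.Perm (Fin n)) (g : Equiv.Perm (Fin K)) :
    SSE Km Qm Vm (X.submatrix e id) (S.submatrix g id) =
      (SSE Km Qm Vm X S).submatrix g id := by
  have hX (B : Matrix (Fin d) (Fin dh) ℝ) (i j) :
      (X.submatrix e id * B) i j = (X * B) (e i) j := rfl
  have hM (i j) : (X.submatrix e id * Km * (S.submatrix g id * Qm)ᵀ) i j =
      (X * Km * (S * Qm)ᵀ) (e i) (g j) := rfl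
  ext i j
  simp only [SSE, Matrix.submatrix_apply, id_eq]
  rw [Matrix.mul_apply, Matrix.mul_apply]
  refine Eq.trans ?_ (Equiv.sum_comp e _)
  refine Finset.sum_congr rfl fun a _ => ?_
  simp only [Matrix.transpose_apply, Matrix.of_apply, Matrix.smul_apply, hM, hX]
  rw [Equiv.sum_comp g fun l =>
    sigmoid ((1 / Real.sqrt dh) • (X * Km * (S * Qm)ᵀ) (e a) l)]

/-- **Permutation invariance/equivariance of the Slot Set Encoder.** For every input
`X ∈ ℝ^{n×d}`, slots `S ∈ ℝ^{K×h}`, and permutation matrices `π_X ∈ ℝ^{n×n}`,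
`π_S ∈ ℝ^{K×K}`, we have `SSE(π_X·X, π_S·S) = π_S·SSE(X, S)`. -/
theorem sse_perm_invariant_equivariant {n d dh h K : ℕ}
    (Km : Matrix (Fin d) (Fin dh) ℝ) (Qm : Matrix (Fin h) (Fin dh) ℝ)
    (Vm : Matrix (Fin d) (Fin dh) ℝ)
    (X : Matrix (Fin n) (Fin d) ℝ) (S : Matrix (Fin K) (Fin h) ℝ)
    (πX : Matrix (Fin n) (Fin n) ℝ) (πS : Matrix (Fin K) (Fin K) ℝ)
    (hπX : IsPermMatrix πX) (hπS : IsPermMatrix πS) :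
    SSE Km Qm Vm (πX * X) (πS * S) = πS * SSE Km Qm Vm X S := by
  obtain ⟨e, he⟩ := hπX.exists_mul_eq_submatrix
  obtain ⟨g, hg⟩ := hπS.exists_mul_eq_submatrix
  rw [he, hg, hg, SSE_submatrix]
end

section
/- Mini-batch encoding with the Slot Set Encoder and sum aggregation is independent of the partition and of the order in which mini-batches are processed: let SSE be the Slot Set Encoder with fixed slots S ∈ ℝ^{K×h} and fixed linear maps q, k, v. If X₁, …, X_p and Y₁, …, Y_r are two families of matrices (with rows in ℝ^d) whose vertical concatenations contain the same rows with the same multiplicities (i.e., they are two partitions of the same multiset of set elements), then Σ_{t=1}^{p} SSE(X_t, S) = Σ_{u=1}^{r} SSE(Y_u, S). -/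
open Matrix

/-- The multiset of rows of a matrix `X ∈ ℝ^{n×d}`. -/
def rowMultiset {n d : ℕ} (X : Matrix (Fin n) (Fin d) ℝ) : Multiset (Fin d → ℝ) :=
  (List.ofFn fun i => X i : List (Fin d → ℝ))

/-- The Slot Set Encoder acts row by row: the encoding of a matrix is the sum of the encodings of
its rows, each regarded as a one-row matrix. -/
lemma SSE_eq_sum_rows {n d dh h K : ℕ}
    (Km : Matrix (Fin d) (Fin dh) ℝ) (Qm : Matrix (Fin h) (Fin dh) ℝ)
    (Vm : Matrix (Fin d) (Fin dh) ℝ)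
    (X : Matrix (Fin n) (Fin d) ℝ) (S : Matrix (Fin K) (Fin h) ℝ) :
    SSE Km Qm Vm X S = ∑ i, SSE Km Qm Vm (Matrix.of fun _ : Fin 1 => X i) S := by
  ext a b
  rw [Matrix.sum_apply]
  simp [SSE, Matrix.mul_apply]

lemma SSE_eq_sum_map_rowMultiset {n d dh h K : ℕ}
    (Km : Matrix (Fin d) (Fin dh) ℝ) (Qm : Matrix (Fin h) (Fin dh) ℝ)
    (Vm : Matrix (Fin d) (Fin dh) ℝ)
    (X : Matrix (Fin n) (Fin d) ℝ) (S : Matrix (Fin K) (Fin h) ℝ) :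
    SSE Km Qm Vm X S =
      ((rowMultiset X).map fun x => SSE Km Qm Vm (Matrix.of fun _ : Fin 1 => x) S).sum := by
  rw [SSE_eq_sum_rows, rowMultiset, Multiset.map_coe, Multiset.sum_coe, List.map_ofFn,
    List.sum_ofFn]
  rfl

/-- **Mini-batch SSE encoding with sum aggregation is independent of the partition and of the
order of the mini-batches.** If `X₁, …, X_p` and `Y₁, …, Y_r` are two families of matrices
(with rows in `ℝ^d`) whose vertical concatenations contain the same rows with the same
multiplicities (two partitions of the same multiset of set elements), then
`∑_{t=1}^{p} SSE(X_t, S) = ∑_{u=1}^{r} SSE(Y_u, S)`. -/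
theorem sse_sum_partition_independent {d dh h K : ℕ}
    (Km : Matrix (Fin d) (Fin dh) ℝ) (Qm : Matrix (Fin h) (Fin dh) ℝ)
    (Vm : Matrix (Fin d) (Fin dh) ℝ) (S : Matrix (Fin K) (Fin h) ℝ)
    {p r : ℕ} (n : Fin p → ℕ) (m : Fin r → ℕ)
    (Xs : ∀ t : Fin p, Matrix (Fin (n t)) (Fin d) ℝ)
    (Ys : ∀ u : Fin r, Matrix (Fin (m u)) (Fin d) ℝ)
    (hrows : ∑ t, rowMultiset (Xs t) = ∑ u, rowMultiset (Ys u)) :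
    ∑ t, SSE Km Qm Vm (Xs t) S = ∑ u, SSE Km Qm Vm (Ys u) S := by
  let f : (Fin d → ℝ) → Matrix (Fin K) (Fin dh) ℝ :=
    fun x => SSE Km Qm Vm (Matrix.of fun _ : Fin 1 => x) S
  have h_sum := congrArg (Multiset.sumAddMonoidHom.comp (Multiset.mapAddMonoidHom f)) hrows
  rw [map_sum, map_sum] at h_sum
  exact (Finset.sum_congr rfl fun t _ => SSE_eq_sum_map_rowMultiset Km Qm Vm (Xs t) S).trans
    (h_sum.trans
      (Finset.sum_congr rfl fun u _ => SSE_eq_sum_map_rowMultiset Km Qm Vm (Ys u) S).symm)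
end
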